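/- Let G be any subgroup of the group of piecewise projective homeomorphisms of the real line: each g ∈ G is an increasing homeomorphism of ℝ for which there exist finitely many points s₁ < ⋯ < sₙ such that on each complementary interval (−∞, s₁], [sᵢ, sᵢ₊₁], [sₙ, ∞), g agrees with a Möbius transformation x ↦ (ax + b)/(cx + d) for some a, b, c, d ∈ ℝ with ad − bc = 1 (and cx + d ≠ 0 on that interval). Then every bounded 2-cocycle ω : G × G → ℝ is a bounded 2-coboundary, i.e. H²_b(G;ℝ) = 0. -/

import Mathlib

/-- `ω : G × G → ℝ` is a bounded 2-cocycle: it is bounded and satisfies the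
2-cocycle identity `ω(g₂,g₃) − ω(g₁g₂,g₃) + ω(g₁,g₂g₃) − ω(g₁,g₂) = 0`. -/
def IsBounded2Cocycle {G : Type*} [Group G] (ω : G → G → ℝ) : Prop :=
  (∃ C : ℝ, ∀ g h : G, |ω g h| ≤ C) ∧
    ∀ g₁ g₂ g₃ : G, ω g₂ g₃ - ω (g₁ * g₂) g₃ + ω g₁ (g₂ * g₃) - ω g₁ g₂ = 0

/-- `ω : G × G → ℝ` is a bounded 2-coboundary: there is a bounded `φ : G → ℝ`
with `ω(g₁,g₂) = φ(g₂) − φ(g₁g₂) + φ(g₁)`. -/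
def IsBounded2Coboundary {G : Type*} [Group G] (ω : G → G → ℝ) : Prop :=
  ∃ φ : G → ℝ, (∃ C : ℝ, ∀ g : G, |φ g| ≤ C) ∧
    ∀ g₁ g₂ : G, ω g₁ g₂ = φ g₂ - φ (g₁ * g₂) + φ g₁

/-- Vanishing of second bounded cohomology with trivial real coefficients:
every bounded 2-cocycle is a bounded 2-coboundary. -/
def HasVanishingH2b (G : Type*) [Group G] : Prop :=
  ∀ ω : G → G → ℝ, IsBounded2Cocycle ω → IsBounded2Coboundary ω

/-- `G` has commuting conjugates: for every finitely generated subgroup `H ≤ G`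
there is `f ∈ G` with `[H, f⁻¹Hf] = 1` elementwise. -/
def HasCommutingConjugates (G : Type*) [Group G] : Prop :=
  ∀ H : Subgroup G, H.FG → ∃ f : G, ∀ h₁ ∈ H, ∀ h₂ ∈ H, Commute h₁ (f⁻¹ * h₂ * f)

/-- `g` agrees on the set `I` with the Möbius transformation
`x ↦ (ax + b)/(cx + d)`, where `ad − bc = 1` and `cx + d ≠ 0` on `I`. -/
def MoebiusOn (g : ℝ → ℝ) (I : Set ℝ) : Prop :=
  ∃ a b c d : ℝ, a * d - b * c = 1 ∧ ∀ x ∈ I, c * x + d ≠ 0 ∧ g x = (a * x + b) / (c * x + d)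

/-- `g : ℝ → ℝ` is piecewise projective: there are finitely many points
`s₁ < ⋯ < sₙ` such that on each of the complementary closed intervals
`(−∞, s₁], [s₁, s₂], …, [sₙ, ∞)` the map `g` agrees with a Möbius transformation. -/
def IsPiecewiseProjective (g : ℝ → ℝ) : Prop :=
  ∃ (n : ℕ) (s : Fin n → ℝ), StrictMono s ∧
    ∀ i : Fin (n + 1), MoebiusOn g
      {x : ℝ | (∀ j : Fin n, (j : ℕ) + 1 ≤ (i : ℕ) → s j ≤ x) ∧
        (∀ j : Fin n, (i : ℕ) ≤ (j : ℕ) → x ≤ s j)}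

/-- A quasimorphism which is homogeneous with respect to squaring. -/
structure IsHomogeneousQuasimorphism {E : Type*} [Group E] (F : E → ℝ) : Prop where
  defect : ∃ D : ℝ, ∀ x y, |F (x * y) - F x - F y| ≤ D
  mul_self : ∀ x, F (x * x) = 2 * F x

/-- `F` is additive on the subgroup `N`. -/
def AdditiveOn {E : Type*} [Group E] (F : E → ℝ) (N : Subgroup E) : Prop :=
  ∀ x ∈ N, ∀ y ∈ N, F (x * y) = F x + F y

lemma eq_zero_of_bounded_of_doubling {α : Type*} {P : α → Prop} {δ : α → ℝ} {C : ℝ}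
    (hb : ∀ p, P p → |δ p| ≤ C) (hd : ∀ p, P p → ∃ q, P q ∧ 2 * |δ p| ≤ |δ q|) (p : α)
    (hp : P p) : δ p = 0 := by
  have key : ∀ (n : ℕ) (p : α), P p → 2 ^ n * |δ p| ≤ C := by
    intro n
    induction n with
    | zero => intro p hp; simpa using hb p hp
    | succ n ih =>
      intro p hp
      obtain ⟨q, hq, hpq⟩ := hd p hp
      have h2 : (0 : ℝ) < 2 ^ n := by positivity
      calc 2 ^ (n + 1) * |δ p| = 2 ^ n * (2 * |δ p|) := by ring
        _ ≤ 2 ^ n * |δ q| := by gcongr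
        _ ≤ C := ih q hq
  by_contra h
  have hpos : 0 < |δ p| := abs_pos.mpr h
  obtain ⟨n, hn⟩ := pow_unbounded_of_one_lt (C / |δ p|) (one_lt_two : (1 : ℝ) < 2)
  rw [div_lt_iff₀ hpos] at hn
  exact absurd (key n p hp) (not_le.mpr hn)

namespace IsHomogeneousQuasimorphism

open scoped commutatorElement

variable {E : Type*} [Group E] {F : E → ℝ}

lemma comp (hF : IsHomogeneousQuasimorphism F) {E' : Type*} [Group E'] (f : E' →* E) :
    IsHomogeneousQuasimorphism (F ∘ f) := by
  obtain ⟨D, hD⟩ := hF.defect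
  exact ⟨⟨D, fun x y ↦ by simpa using hD (f x) (f y)⟩, fun x ↦ by simpa using hF.mul_self (f x)⟩

lemma map_one (hF : IsHomogeneousQuasimorphism F) : F 1 = 0 := by
  have := hF.mul_self 1
  rw [mul_one] at this
  linarith

lemma map_conj (hF : IsHomogeneousQuasimorphism F) (g x : E) : F (g * x * g⁻¹) = F x := by
  obtain ⟨D, hD⟩ := hF.defect
  have h := eq_zero_of_bounded_of_doubling (P := fun _ ↦ True)
    (δ := fun x ↦ F (g * x * g⁻¹) - F x) (C := 2 * D + |F g| + |F g⁻¹|) ?_ ?_ x trivial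
  · linarith
  · intro x _
    have h1 := abs_le.mp (hD (g * x) g⁻¹)
    have h2 := abs_le.mp (hD g x)
    have h3 := abs_le.mp (le_refl |F g|)
    have h4 := abs_le.mp (le_refl |F g⁻¹|)
    exact abs_le.mpr ⟨by linarith, by linarith⟩
  · intro x _
    refine ⟨x * x, trivial, le_of_eq ?_⟩
    have : g * (x * x) * g⁻¹ = (g * x * g⁻¹) * (g * x * g⁻¹) := by group
    simp only [this, hF.mul_self]
    rw [← mul_sub, abs_mul, abs_two]

lemma map_mul_comm (hF : IsHomogeneousQuasimorphism F) (x y : E) : F (x * y) = F (y * x) := by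
  rw [← hF.map_conj y (x * y)]
  congr 1
  group

lemma map_mul_of_mem (hF : IsHomogeneousQuasimorphism F) {N : Subgroup E} [N.Normal]
    (hN : AdditiveOn F N) (x : E) {n : E} (hn : n ∈ N) : F (x * n) = F x + F n := by
  obtain ⟨D, hD⟩ := hF.defect
  have h := eq_zero_of_bounded_of_doubling (P := fun p : E × E ↦ p.2 ∈ N)
    (δ := fun p ↦ F (p.1 * p.2) - F p.1 - F p.2) (C := D) (fun p _ ↦ hD _ _) ?_ (x, n) hn
  · linarith
  · rintro ⟨x, n⟩ hn
    have hc : x⁻¹ * n * x ∈ N := by simpa using Subgroup.Normal.conj_mem ‹_› n hn x⁻¹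
    refine ⟨(x * x, x⁻¹ * n * x * n), N.mul_mem hc hn, le_of_eq ?_⟩
    have h1 : x * x * (x⁻¹ * n * x * n) = (x * n) * (x * n) := by group
    have h2 : F (x⁻¹ * n * x) = F n := by simpa using hF.map_conj x⁻¹ n
    simp only [h1, hF.mul_self, hN _ hc _ hn, h2]
    rw [← abs_two, ← abs_mul, abs_two]
    congr 1
    ring

lemma map_commutator_of_mem (hF : IsHomogeneousQuasimorphism F) {N : Subgroup E} [N.Normal]
    (hN : AdditiveOn F N) {x y : E} (h : ⁅x, y⁆ ∈ N) : F ⁅x, y⁆ = 0 := by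
  have h1 := hF.map_mul_of_mem hN y h
  rw [hF.map_mul_comm, commutatorElement_def, inv_mul_cancel_right, hF.map_conj] at h1
  rw [commutatorElement_def]
  linarith

lemma commutator_mem_iff_commute_mk {N : Subgroup E} [N.Normal] {x y : E} :
    ⁅x, y⁆ ∈ N ↔ Commute (x : E ⧸ N) (y : E ⧸ N) := by
  rw [← commutatorElement_eq_one_iff_commute, ← QuotientGroup.eq_one_iff]
  rfl

lemma map_mul_of_commute (hF : IsHomogeneousQuasimorphism F) {N : Subgroup E} [N.Normal]
    (hN : AdditiveOn F N) {x y : E} (h : Commute (x : E ⧸ N) (y : E ⧸ N)) :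
    F (x * y) = F x + F y := by
  obtain ⟨D, hD⟩ := hF.defect
  have h := eq_zero_of_bounded_of_doubling
    (P := fun p : E × E ↦ Commute (p.1 : E ⧸ N) (p.2 : E ⧸ N))
    (δ := fun p ↦ F (p.1 * p.2) - F p.1 - F p.2) (C := D) (fun p _ ↦ hD _ _) ?_ (x, y) h
  · linarith
  · rintro ⟨x, y⟩ h
    dsimp only at h
    refine ⟨(x * x, y * y), ?_, le_of_eq ?_⟩
    · exact (h.mul_left h).mul_right (h.mul_left h)
    have hc : ⁅y⁻¹, x⁻¹⁆ ∈ N := commutator_mem_iff_commute_mk.mpr h.symm.inv_inv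
    have h0 := hF.map_commutator_of_mem hN hc
    have h1 : x * y * (x * y) = x * x * (y * y) * (y⁻¹ * ⁅y⁻¹, x⁻¹⁆ * y⁻¹⁻¹) := by
      rw [commutatorElement_def]
      group
    have h2 : F (x * x * (y * y)) = 2 * F (x * y) := by
      rw [← hF.mul_self, h1, hF.map_mul_of_mem hN _ (Subgroup.Normal.conj_mem ‹_› _ hc _),
        hF.map_conj, h0, add_zero]
    simp only [h2, hF.mul_self]
    rw [← abs_two, ← abs_mul, abs_two]
    congr 1
    ring

/-- If pairs of elements of `M` commute, modulo `N`, with some conjugates of themselves, then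
additivity extends from `N` to `M`. -/
lemma additiveOn_of_commuting_conjugates (hF : IsHomogeneousQuasimorphism F) {N M : Subgroup E}
    [N.Normal] [M.Normal] (hN : AdditiveOn F N)
    (h : ∀ x ∈ M, ∀ y ∈ M, ∃ g : E, ∀ z ∈ ({x, y} : Set E), ∀ w ∈ ({x, y} : Set E),
      ⁅z, g * w * g⁻¹⁆ ∈ N) : AdditiveOn F M := by
  intro x hx y hy
  obtain ⟨D, hD⟩ := hF.defect
  have h := eq_zero_of_bounded_of_doubling
    (P := fun p : E × E ↦ p.1 ∈ M ∧ p.2 ∈ M)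
    (δ := fun p ↦ F (p.1 * p.2) - F p.1 - F p.2) (C := D) (fun p _ ↦ hD _ _) ?_ (x, y) ⟨hx, hy⟩
  · linarith
  · rintro ⟨x, y⟩ ⟨hx, hy⟩
    dsimp only at hx hy
    obtain ⟨g, hg⟩ := h x hx y hy
    simp only [commutator_mem_iff_commute_mk, Set.mem_insert_iff, Set.mem_singleton_iff,
      forall_eq_or_imp, forall_eq] at hg
    obtain ⟨⟨hxx, hxy⟩, hyx, hyy⟩ := hg
    have hx' := hF.map_conj g x
    have hy' := hF.map_conj g y
    have hxy' := hF.map_conj g (x * y)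
    have hmul : g * (x * y) * g⁻¹ = (g * x * g⁻¹) * (g * y * g⁻¹) := by group
    have hMx : g * x * g⁻¹ ∈ M := Subgroup.Normal.conj_mem ‹_› x hx g
    have hMy : g * y * g⁻¹ ∈ M := Subgroup.Normal.conj_mem ‹_› y hy g
    rw [hmul] at hxy'
    generalize g * x * g⁻¹ = x' at *
    generalize g * y * g⁻¹ = y' at *
    refine ⟨(x * x', y * y'), ⟨M.mul_mem hx hMx, M.mul_mem hy hMy⟩, le_of_eq ?_⟩
    have h1 : F (x * x') = 2 * F x := by
      rw [hF.map_mul_of_commute hN hxx, hx']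
      ring
    have h2 : F (y * y') = 2 * F y := by
      rw [hF.map_mul_of_commute hN hyy, hy']
      ring
    have h3 : F ((x * y) * (x' * y')) = 2 * F (x * y) := by
      rw [hF.map_mul_of_commute hN, hxy', two_mul]
      exact (hxx.mul_right hxy).mul_left (hyx.mul_right hyy)
    have hc : ⁅y⁻¹, x'⁻¹⁆ ∈ N := commutator_mem_iff_commute_mk.mpr hyx.inv_inv
    have h0 := hF.map_commutator_of_mem hN hc
    have h4 : x * y * (x' * y') = x * x' * (y * y') * (y'⁻¹ * ⁅y⁻¹, x'⁻¹⁆ * y'⁻¹⁻¹) := by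
      rw [commutatorElement_def]
      group
    have h5 : F (x * x' * (y * y')) = 2 * F (x * y) := by
      rw [← h3, h4, hF.map_mul_of_mem hN _ (Subgroup.Normal.conj_mem ‹_› _ hc _),
        hF.map_conj, h0, add_zero]
    simp only [h1, h2, h5]
    rw [← abs_two, ← abs_mul, abs_two]
    congr 1
    ring

lemma additiveOn_derivedSeries_of_succ (hF : IsHomogeneousQuasimorphism F) {n : ℕ}
    (h : AdditiveOn F (derivedSeries E (n + 1))) : AdditiveOn F (derivedSeries E n) := by
  refine hF.additiveOn_of_commuting_conjugates h fun x hx y hy ↦ ⟨1, ?_⟩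
  have : ∀ z ∈ ({x, y} : Set E), z ∈ derivedSeries E n := by
    rintro z (rfl | rfl) <;> assumption
  intro z hz w hw
  rw [one_mul, inv_one, mul_one, derivedSeries_succ]
  exact Subgroup.commutator_mem_commutator (this z hz) (this w hw)

/-- Every quasimorphism is at bounded distance from a homogeneous one. -/
lemma exists_near {f : E → ℝ} {D : ℝ} (hf : ∀ x y, |f (x * y) - f x - f y| ≤ D) :
    ∃ F : E → ℝ, IsHomogeneousQuasimorphism F ∧ ∀ x, |F x - f x| ≤ D := by
  have hstep : ∀ x (n : ℕ), dist (f (x ^ 2 ^ n) / 2 ^ n) (f (x ^ 2 ^ (n + 1)) / 2 ^ (n + 1)) ≤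
      D / 2 / 2 ^ n := by
    intro x n
    have h1 := hf (x ^ 2 ^ n) (x ^ 2 ^ n)
    rw [← pow_add, ← two_mul, ← pow_succ'] at h1
    have h2 : f (x ^ 2 ^ n) / 2 ^ n - f (x ^ 2 ^ (n + 1)) / 2 ^ (n + 1) =
        -(f (x ^ 2 ^ (n + 1)) - f (x ^ 2 ^ n) - f (x ^ 2 ^ n)) / 2 / 2 ^ n := by
      field_simp
      ring
    rw [Real.dist_eq, h2, abs_div, abs_div, abs_neg, abs_two, abs_of_pos (by positivity : (0 : ℝ) < 2 ^ n)]
    gcongr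
  choose F hF using fun x ↦ cauchySeq_tendsto_of_complete (cauchySeq_of_le_geometric_two (hstep x))
  have hnear : ∀ x, |F x - f x| ≤ D := by
    intro x
    have := dist_le_of_le_geometric_two_of_tendsto₀ (hstep x) (hF x)
    rw [dist_comm, Real.dist_eq] at this
    simpa using this
  refine ⟨F, ⟨⟨4 * D, fun x y ↦ ?_⟩, fun x ↦ ?_⟩, hnear⟩
  · have h1 := abs_le.mp (hnear x)
    have h2 := abs_le.mp (hnear y)
    have h3 := abs_le.mp (hnear (x * y))
    have h4 := abs_le.mp (hf x y)
    exact abs_le.mpr ⟨by linarith, by linarith⟩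
  · refine tendsto_nhds_unique (hF (x * x))
      ((((hF x).comp (Filter.tendsto_add_atTop_nat 1)).const_mul 2).congr fun n ↦ ?_)
    have : (x * x) ^ 2 ^ n = x ^ 2 ^ (n + 1) := by
      rw [← pow_two, ← pow_mul, ← pow_succ']
    simp only [Function.comp_apply, this]
    field_simp
    ring

end IsHomogeneousQuasimorphism

namespace LineAction

open scoped commutatorElement

lemma exists_lt_apply {E : Type*} [Group E] {ρ : E →* Equiv.Perm ℝ} (hρ : ∀ e, StrictMono (ρ e))
    {p q : ℝ} (h : ∀ x, p ≤ x → x ≤ q → ∃ e, ρ e x ≠ x) : ∃ e, q < ρ e p := by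
  by_contra! hle
  have hbdd : BddAbove (Set.range fun e ↦ ρ e p) := ⟨q, by rintro _ ⟨e, rfl⟩; exact hle e⟩
  have hp : p ≤ ⨆ e, ρ e p := by simpa using le_ciSup hbdd 1
  obtain ⟨e, he⟩ := h _ hp (ciSup_le hle)
  have key : ∀ e, ρ e (⨆ e, ρ e p) ≤ ⨆ e, ρ e p := by
    intro e
    have h1 : ⨆ e, ρ e p ≤ ρ e⁻¹ (⨆ e, ρ e p) := by
      refine ciSup_le fun e' ↦ ?_
      have h2 := (hρ e⁻¹).monotone (le_ciSup hbdd (e * e'))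
      simpa using h2
    simpa using (hρ e).monotone h1
  refine he (le_antisymm (key e) ?_)
  simpa using (hρ e).monotone (key e⁻¹)

lemma commutator_apply_eq_self {E : Type*} [Group E] {ρ : E →* Equiv.Perm ℝ}
    (hρ : ∀ e, StrictMono (ρ e)) {I : Set ℝ} (hI : ∀ e, ∀ s ∈ I, ρ e s ∈ I) {p q : ℝ}
    (hp : p ∈ I) (hq : q ∈ I) {x y g : E} (hg : q < ρ g p)
    (hx : ∀ s ∈ I, s ≤ p ∨ q ≤ s → ρ x s = s) (hy : ∀ s ∈ I, s ≤ p ∨ q ≤ s → ρ y s = s)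
    {s : ℝ} (hs : s ∈ I) : ρ ⁅x, g * y * g⁻¹⁆ s = s := by
  have key : ∀ s ∈ I, ρ (x * (g * y * g⁻¹)) s = ρ (g * y * g⁻¹ * x) s := by
    intro s hs
    have hlow : ∀ r ∈ I, r < ρ g p → ρ (g * y * g⁻¹) r = r := by
      intro r hr hrg
      have h1 : ρ g⁻¹ r < p := by simpa using hρ g⁻¹ hrg
      have h2 := hy _ (hI g⁻¹ r hr) (Or.inl h1.le)
      rw [map_mul, map_mul, Equiv.Perm.mul_apply, Equiv.Perm.mul_apply, h2]
      simp
    rw [map_mul, map_mul _ (g * y * g⁻¹), Equiv.Perm.mul_apply, Equiv.Perm.mul_apply]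
    rcases lt_or_ge s (ρ g p) with h | h
    · rw [hlow s hs h, hlow _ (hI x s hs)]
      rcases le_total s q with hsq | hsq
      · refine lt_of_le_of_lt ?_ hg
        simpa [hx q hq (Or.inr le_rfl)] using (hρ x).monotone hsq
      · rwa [hx s hs (Or.inr hsq)]
    · rw [hx s hs (Or.inr (hg.le.trans h)), hx _ (hI _ s hs)]
      right
      have h1 := (hρ (g * y * g⁻¹)).monotone h
      have h2 : ρ (g * y * g⁻¹) (ρ g p) = ρ g p := by
        simp [hy p hp (Or.inl le_rfl)]
      rw [h2] at h1
      exact hg.le.trans h1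
  have h1 := key _ (hI ((g * y * g⁻¹ * x)⁻¹) s hs)
  rw [← Equiv.Perm.mul_apply, ← Equiv.Perm.mul_apply, ← map_mul, ← map_mul, mul_inv_cancel,
    map_one, Equiv.Perm.one_apply] at h1
  have h2 : ⁅x, g * y * g⁻¹⁆ = x * (g * y * g⁻¹) * (g * y * g⁻¹ * x)⁻¹ := by
    rw [commutatorElement_def]
    group
  rwa [h2]

/-- The elements of the second derived subgroup acting trivially on `(-∞, t]`. -/
def fixer {E : Type*} [Group E] (ρ : E →* Equiv.Perm ℝ) (t : EReal) : Subgroup E :=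
  derivedSeries E 2 ⊓ (fixingSubgroup (Equiv.Perm ℝ) {x : ℝ | (x : EReal) ≤ t}).comap ρ

lemma mem_fixer {E : Type*} [Group E] {ρ : E →* Equiv.Perm ℝ} {t : EReal} {e : E} :
    e ∈ fixer ρ t ↔ e ∈ derivedSeries E 2 ∧ ∀ x : ℝ, (x : EReal) ≤ t → ρ e x = x := by
  simp [fixer, mem_fixingSubgroup_iff]

lemma lt_of_fixed {E : Type*} [Group E] {ρ : E →* Equiv.Perm ℝ} (hρ : ∀ e, StrictMono (ρ e))
    {t : EReal} (ht : ∀ e (x : ℝ), (x : EReal) = t → ρ e x = x) (e : E) {x : ℝ}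
    (hx : (x : EReal) < t) : ((ρ e x : ℝ) : EReal) < t := by
  induction t with
  | bot => simp at hx
  | top => exact EReal.coe_lt_top _
  | coe r =>
    rw [EReal.coe_lt_coe_iff] at hx ⊢
    simpa [ht e r rfl] using hρ e hx

lemma gt_of_fixed {E : Type*} [Group E] {ρ : E →* Equiv.Perm ℝ} (hρ : ∀ e, StrictMono (ρ e))
    {t : EReal} (ht : ∀ e (x : ℝ), (x : EReal) = t → ρ e x = x) (e : E) {x : ℝ}
    (hx : t < (x : EReal)) : t < ((ρ e x : ℝ) : EReal) := by
  induction t with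
  | bot => exact EReal.bot_lt_coe _
  | top => simp at hx
  | coe r =>
    rw [EReal.coe_lt_coe_iff] at hx ⊢
    simpa [ht e r rfl] using hρ e hx

lemma fixer_normal {E : Type*} [Group E] {ρ : E →* Equiv.Perm ℝ} (hρ : ∀ e, StrictMono (ρ e))
    {t : EReal} (ht : ∀ e (x : ℝ), (x : EReal) = t → ρ e x = x) : (fixer ρ t).Normal := by
  refine ⟨fun n hn g ↦ ?_⟩
  rw [mem_fixer] at hn ⊢
  refine ⟨Subgroup.Normal.conj_mem inferInstance n hn.1 g, fun x hx ↦ ?_⟩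
  have h1 : ((ρ g⁻¹ x : ℝ) : EReal) ≤ t := by
    rcases hx.lt_or_eq with h | h
    · exact (lt_of_fixed hρ ht g⁻¹ h).le
    · rwa [ht _ _ h]
  rw [map_mul, map_mul, Equiv.Perm.mul_apply, Equiv.Perm.mul_apply, hn.2 _ h1]
  simp

/-- Additivity propagates from `fixer ρ t'` to `fixer ρ t` across an interval `(t, t')`
containing no global fixed point. -/
lemma additiveOn_fixer_step {E : Type*} [Group E] {F : E → ℝ}
    (hF : IsHomogeneousQuasimorphism F) {ρ : E →* Equiv.Perm ℝ} (hρ : ∀ e, StrictMono (ρ e))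
    {t t' : EReal} (htt : t < t')
    (ht : ∀ e (x : ℝ), (x : EReal) = t → ρ e x = x)
    (ht' : ∀ e (x : ℝ), (x : EReal) = t' → ρ e x = x)
    (hmove : ∀ x : ℝ, t < x → x < t' → ∃ e, ρ e x ≠ x)
    (hright : ∀ e ∈ derivedSeries E 2, ∃ p : ℝ, t < p ∧ ∀ x : ℝ, t < x → x ≤ p → ρ e x = x)
    (hleft : ∀ e ∈ derivedSeries E 2, ∃ q : ℝ, q < t' ∧ ∀ x : ℝ, q ≤ x → x < t' → ρ e x = x)
    (h : AdditiveOn F (fixer ρ t')) : AdditiveOn F (fixer ρ t) := by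
  have := fixer_normal hρ ht
  have := fixer_normal hρ ht'
  refine hF.additiveOn_of_commuting_conjugates h fun x hx y hy ↦ ?_
  obtain ⟨m, hm, hm'⟩ := EReal.lt_iff_exists_real_btwn.mp htt
  obtain ⟨p₁, hp₁, hxp⟩ := hright x (mem_fixer.mp hx).1
  obtain ⟨p₂, hp₂, hyp⟩ := hright y (mem_fixer.mp hy).1
  obtain ⟨q₁, hq₁, hxq⟩ := hleft x (mem_fixer.mp hx).1
  obtain ⟨q₂, hq₂, hyq⟩ := hleft y (mem_fixer.mp hy).1
  set p := min m (min p₁ p₂) with hp_def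
  set q := max m (max q₁ q₂) with hq_def
  have hpm : p ≤ m := min_le_left _ _
  have hmq : m ≤ q := le_max_left _ _
  have hp : t < p := by
    rcases min_choice m (min p₁ p₂) with h | h <;> rw [hp_def, h]
    · exact hm
    rcases min_choice p₁ p₂ with h | h <;> rw [h] <;> assumption
  have hq : (q : EReal) < t' := by
    rcases max_choice m (max q₁ q₂) with h | h <;> rw [hq_def, h]
    · exact hm'
    rcases max_choice q₁ q₂ with h | h <;> rw [h] <;> assumption
  have hp' : (p : EReal) < t' := lt_of_le_of_lt (EReal.coe_le_coe_iff.mpr hpm) hm'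
  have hq' : t < q := lt_of_lt_of_le hm (EReal.coe_le_coe_iff.mpr hmq)
  obtain ⟨g, hg⟩ := exists_lt_apply hρ fun x hpx hxq ↦
    hmove x (hp.trans_le (EReal.coe_le_coe_iff.mpr hpx))
      (lt_of_le_of_lt (EReal.coe_le_coe_iff.mpr hxq) hq)
  have hM : ∀ z ∈ ({x, y} : Set E), z ∈ fixer ρ t := by
    rintro z (rfl | rfl) <;> assumption
  have hfix : ∀ z ∈ ({x, y} : Set E), ∀ s ∈ {s : ℝ | t < s ∧ s < t'}, s ≤ p ∨ q ≤ s →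
      ρ z s = s := by
    rintro z (rfl | rfl) s ⟨hs, hs'⟩ (h | h)
    · exact hxp s hs (h.trans ((min_le_right _ _).trans (min_le_left _ _)))
    · exact hxq s (((le_max_left _ _).trans (le_max_right _ _)).trans h) hs'
    · exact hyp s hs (h.trans ((min_le_right _ _).trans (min_le_right _ _)))
    · exact hyq s (((le_max_right _ _).trans (le_max_right _ _)).trans h) hs'
  refine ⟨g, fun z hz w hw ↦ ?_⟩
  have hmem : ⁅z, g * w * g⁻¹⁆ ∈ fixer ρ t := by
    have hz' := hM z hz
    have hw' := Subgroup.Normal.conj_mem ‹_› w (hM w hw) g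
    rw [commutatorElement_def]
    exact mul_mem (mul_mem (mul_mem hz' hw') (inv_mem hz')) (inv_mem hw')
  rw [mem_fixer] at hmem ⊢
  refine ⟨hmem.1, fun s hs ↦ ?_⟩
  rcases le_or_gt (s : EReal) t with hst | hst
  · exact hmem.2 s hst
  rcases hs.lt_or_eq with hs | hs
  · exact commutator_apply_eq_self hρ (I := {s : ℝ | t < s ∧ s < t'})
      (fun e s hs ↦ ⟨gt_of_fixed hρ ht e hs.1, lt_of_fixed hρ ht' e hs.2⟩)
      ⟨hp, hp'⟩ ⟨hq', hq⟩ hg (hfix z hz) (hfix w hw) ⟨hst, hs⟩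
  · exact ht' _ _ hs

/-- A homogeneous quasimorphism on a group acting on the line is additive if it is additive on
the kernel, the line is cut by finitely many global fixed points into intervals which are either
pointwise fixed or without global fixed points, and the second derived subgroup has trivial germs
at the endpoints of these intervals. -/
theorem additiveOn_top_of_endpoints {E : Type*} [Group E] {F : E → ℝ}
    (hF : IsHomogeneousQuasimorphism F) {ρ : E →* Equiv.Perm ℝ} (hρ : ∀ e, StrictMono (ρ e))
    (hker : AdditiveOn F ρ.ker) {T : Finset EReal} (hbot : ⊥ ∈ T) (htop : ⊤ ∈ T)
    (hT : ∀ t ∈ T, ∀ e (x : ℝ), (x : EReal) = t → ρ e x = x)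
    (hgap : ∀ t ∈ T, ∀ t' ∈ T, t < t' → (∀ s ∈ T, t < s → t' ≤ s) →
      (∀ x : ℝ, t < x → x < t' → ∀ e, ρ e x = x) ∨
        ∀ x : ℝ, t < x → x < t' → ∃ e, ρ e x ≠ x)
    (hright : ∀ t ∈ T, t < ⊤ → ∀ e ∈ derivedSeries E 2,
      ∃ p : ℝ, t < p ∧ ∀ x : ℝ, t < x → x ≤ p → ρ e x = x)
    (hleft : ∀ t ∈ T, ⊥ < t → ∀ e ∈ derivedSeries E 2,
      ∃ q : ℝ, q < t ∧ ∀ x : ℝ, q ≤ x → x < t → ρ e x = x) : AdditiveOn F ⊤ := by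
  have h0 : AdditiveOn F (derivedSeries E 2) → AdditiveOn F ⊤ := fun h ↦ by
    simpa using hF.additiveOn_derivedSeries_of_succ (hF.additiveOn_derivedSeries_of_succ h)
  apply h0
  suffices AdditiveOn F (fixer ρ ⊥) by
    have hb : fixer ρ ⊥ = derivedSeries E 2 := by
      ext e
      simp [mem_fixer]
    rwa [hb] at this
  by_contra hbad
  classical
  obtain ⟨t, htmem, htmax⟩ := (T.filter fun t ↦ ¬ AdditiveOn F (fixer ρ t)).exists_max_image id
    ⟨⊥, by simp [hbot, hbad]⟩
  rw [Finset.mem_filter] at htmem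
  obtain ⟨htT, htbad⟩ := htmem
  have httop : t < ⊤ := by
    refine lt_top_iff_ne_top.mpr ?_
    rintro rfl
    refine htbad fun x hx y hy ↦ hker x ?_ y ?_
    · ext s; simpa using (mem_fixer.mp hx).2 s le_top
    · ext s; simpa using (mem_fixer.mp hy).2 s le_top
  obtain ⟨t', ht'mem, ht'min⟩ := (T.filter fun s ↦ t < s).exists_min_image id
    ⟨⊤, by simp [htop, httop]⟩
  rw [Finset.mem_filter] at ht'mem
  obtain ⟨ht'T, htt⟩ := ht'mem
  have hgood : AdditiveOn F (fixer ρ t') := by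
    by_contra hb
    exact absurd (htmax t' (by simp [ht'T, hb])) (not_le.mpr htt)
  rcases hgap t htT t' ht'T htt (fun s hs hts ↦ ht'min s (by simp [hs, hts])) with hall | hmove
  · have hsub : ∀ x ∈ fixer ρ t, x ∈ fixer ρ t' := by
      intro x hx
      rw [mem_fixer] at hx ⊢
      refine ⟨hx.1, fun s hs ↦ ?_⟩
      rcases le_or_gt (s : EReal) t with hst | hst
      · exact hx.2 s hst
      rcases hs.lt_or_eq with hs | hs
      · exact hall s hst hs x
      · exact hT t' ht'T x s hs
    exact htbad fun x hx y hy ↦ hgood x (hsub x hx) y (hsub y hy)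
  · exact htbad (additiveOn_fixer_step hF hρ htt (hT t htT) (hT t' ht'T) hmove
      (hright t htT httop) (hleft t' ht'T (bot_le.trans_lt htt)) hgood)

/-- If all group elements are affine near the limit of `l` in the coordinate `u`, then the second
derived subgroup has trivial germs along `l`. -/
lemma eventually_apply_eq_self_of_affine {E : Type*} [Group E] {ρ : E →* Equiv.Perm ℝ}
    {l : Filter ℝ} {u : ℝ → ℝ} (hu : Function.Injective u)
    (hl : ∀ e, Filter.Tendsto (ρ e) l l)
    (haff : ∀ e, ∃ a b : ℝ, a ≠ 0 ∧ ∀ᶠ x in l, u (ρ e x) = a * u x + b) {e : E}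
    (he : e ∈ derivedSeries E 2) : ∀ᶠ x in l, ρ e x = x := by
  have hinv : ∀ (e : E) (a b : ℝ), a ≠ 0 → (∀ᶠ x in l, u (ρ e x) = a * u x + b) →
      ∀ᶠ x in l, u (ρ e⁻¹ x) = (u x - b) / a := by
    intro e a b ha h
    filter_upwards [(hl e⁻¹).eventually h] with x hx
    have h1 : ρ e (ρ e⁻¹ x) = x := by simp
    rw [h1] at hx
    rw [hx]
    field_simp
    ring
  let S₁ : Subgroup E :=
    { carrier := {e | ∃ b : ℝ, ∀ᶠ x in l, u (ρ e x) = u x + b}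
      one_mem' := ⟨0, by simp⟩
      mul_mem' := by
        rintro x y ⟨b, hb⟩ ⟨c, hc⟩
        refine ⟨c + b, ?_⟩
        filter_upwards [(hl y).eventually hb, hc] with s h1 h2
        rw [map_mul, Equiv.Perm.mul_apply, h1, h2]
        ring
      inv_mem' := by
        rintro x ⟨b, hb⟩
        refine ⟨-b, ?_⟩
        filter_upwards [hinv x 1 b one_ne_zero (by simpa using hb)] with s hs
        rw [hs]
        ring }
  let S₂ : Subgroup E :=
    { carrier := {e | ∀ᶠ x in l, ρ e x = x}
      one_mem' := by simp
      mul_mem' := by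
        intro x y hx hy
        filter_upwards [hx, hy] with s h1 h2
        rw [map_mul, Equiv.Perm.mul_apply, h2, h1]
      inv_mem' := by
        intro x hx
        filter_upwards [hx] with s h1
        rw [map_inv, Equiv.Perm.inv_eq_iff_eq, h1] }
  have h1 : derivedSeries E 1 ≤ S₁ := by
    rw [derivedSeries_succ, Subgroup.commutator_le]
    intro x _ y _
    obtain ⟨a, b, ha, hx⟩ := haff x
    obtain ⟨c, d, hc, hy⟩ := haff y
    have hx' := hinv x a b ha hx
    have hy' := hinv y c d hc hy
    refine ⟨a * d + b - c * b - d, ?_⟩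
    filter_upwards [hy', (hl y⁻¹).eventually hx', ((hl x⁻¹).comp (hl y⁻¹)).eventually hy,
      ((hl y).comp ((hl x⁻¹).comp (hl y⁻¹))).eventually hx] with s h1 h2 h3 h4
    simp only [Function.comp_apply] at h3 h4
    simp only [commutatorElement_def, map_mul, Equiv.Perm.mul_apply]
    rw [h4, h3, h2, h1]
    field_simp
    ring
  have h2 : derivedSeries E 2 ≤ S₂ := by
    rw [derivedSeries_succ, Subgroup.commutator_le]
    intro x hx y hy
    obtain ⟨b, hx⟩ := h1 hx
    obtain ⟨d, hy⟩ := h1 hy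
    have hx' := hinv x 1 b one_ne_zero (by simpa using hx)
    have hy' := hinv y 1 d one_ne_zero (by simpa using hy)
    change ∀ᶠ s in l, ρ ⁅x, y⁆ s = s
    filter_upwards [hy', (hl y⁻¹).eventually hx', ((hl x⁻¹).comp (hl y⁻¹)).eventually hy,
      ((hl y).comp ((hl x⁻¹).comp (hl y⁻¹))).eventually hx] with s h1 h2 h3 h4
    simp only [Function.comp_apply] at h3 h4
    apply hu
    simp only [commutatorElement_def, map_mul, Equiv.Perm.mul_apply]
    rw [h4, h3, h2, h1]
    ring
  exact h2 he

end LineAction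

section PiecewiseProjective

open Filter Topology

lemma exists_fin_split {n : ℕ} {P : Fin n → Prop} (hP : ∀ j k, j ≤ k → P k → P j) :
    ∃ i : Fin (n + 1), (∀ j : Fin n, (j : ℕ) + 1 ≤ i → P j) ∧
      ∀ j : Fin n, (i : ℕ) ≤ j → ¬ P j := by
  classical
  by_cases h : ∃ m, ∃ hm : m < n, ¬ P ⟨m, hm⟩
  · obtain ⟨hm, hPm⟩ := Nat.find_spec h
    refine ⟨⟨Nat.find h, by omega⟩, fun j hj ↦ ?_, fun j hj hPj ↦ hPm (hP _ j hj hPj)⟩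
    by_contra hPj
    exact Nat.find_min h (m := j) hj ⟨j.2, hPj⟩
  · push Not at h
    refine ⟨Fin.last n, fun j _ ↦ h j j.2, fun j hj ↦ ?_⟩
    have := j.2
    simp at hj
    omega

/-- A piecewise projective map is given by one of finitely many Möbius transformations along any
filter which is eventually on one side of each breakpoint. -/
lemma IsPiecewiseProjective.exists_eventually {g : ℝ → ℝ} (hg : IsPiecewiseProjective g) :
    ∃ (n : ℕ) (s : Fin n → ℝ) (a b c d : Fin (n + 1) → ℝ), (∀ i, a i * d i - b i * c i = 1) ∧
      ∀ l : Filter ℝ, (∀ j, (∀ᶠ x in l, x ≤ s j) ∨ ∀ᶠ x in l, s j ≤ x) →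
        ∃ i, ∀ᶠ x in l, c i * x + d i ≠ 0 ∧ g x = (a i * x + b i) / (c i * x + d i) := by
  obtain ⟨n, s, hs, h⟩ := hg
  choose a b c d hdet h using h
  refine ⟨n, s, a, b, c, d, hdet, fun l hl ↦ ?_⟩
  obtain ⟨i, hi, hi'⟩ := exists_fin_split (P := fun j ↦ ∀ᶠ x in l, s j ≤ x)
    fun j k hjk hk ↦ hk.mono fun x hx ↦ (hs.monotone hjk).trans hx
  refine ⟨i, ?_⟩
  have h1 : ∀ᶠ x in l, ∀ j : Fin n, (j : ℕ) + 1 ≤ i → s j ≤ x := by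
    refine eventually_all.mpr fun j ↦ ?_
    by_cases hj : (j : ℕ) + 1 ≤ i
    · exact (hi j hj).mono fun _ hx _ ↦ hx
    · exact Eventually.of_forall fun _ hj' ↦ absurd hj' hj
  have h2 : ∀ᶠ x in l, ∀ j : Fin n, (i : ℕ) ≤ j → x ≤ s j := by
    refine eventually_all.mpr fun j ↦ ?_
    by_cases hj : (i : ℕ) ≤ j
    · exact ((hl j).resolve_right (hi' j hj)).mono fun _ hx _ ↦ hx
    · exact Eventually.of_forall fun _ hj' ↦ absurd hj' hj
  filter_upwards [h1, h2] with x hx1 hx2 using h i x ⟨hx1, hx2⟩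

lemma IsPiecewiseProjective.exists_moebius {g : ℝ → ℝ} (hg : IsPiecewiseProjective g)
    {l : Filter ℝ} (hl : ∀ r : ℝ, (∀ᶠ x in l, x ≤ r) ∨ ∀ᶠ x in l, r ≤ x) :
    ∃ a b c d : ℝ, a * d - b * c = 1 ∧
      ∀ᶠ x in l, c * x + d ≠ 0 ∧ g x = (a * x + b) / (c * x + d) := by
  obtain ⟨n, s, a, b, c, d, hdet, h⟩ := hg.exists_eventually
  obtain ⟨i, hi⟩ := h l fun j ↦ hl (s j)
  exact ⟨a i, b i, c i, d i, hdet i, hi⟩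

open Polynomial in
lemma finite_setOf_quadratic_eq_zero {p q r : ℝ} (h : ¬ (p = 0 ∧ q = 0 ∧ r = 0)) :
    {x : ℝ | p * x ^ 2 + q * x + r = 0}.Finite := by
  have hne : C p * X ^ 2 + C q * X + C r ≠ 0 := by
    intro h0
    refine h ⟨?_, ?_, ?_⟩
    · simpa [coeff_X, coeff_C] using congrArg (coeff · 2) h0
    · simpa [coeff_X, coeff_C] using congrArg (coeff · 1) h0
    · simpa [coeff_X, coeff_C] using congrArg (coeff · 0) h0
  refine (C p * X ^ 2 + C q * X + C r).roots.toFinset.finite_toSet.subset fun x hx ↦ ?_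
  simpa [mem_roots hne] using hx

lemma IsPiecewiseProjective.finite_frontier_fixed {g : ℝ → ℝ} (hg : IsPiecewiseProjective g)
    (hc : Continuous g) : (frontier {x | g x = x}).Finite := by
  obtain ⟨n, s, a, b, c, d, hdet, h⟩ := hg.exists_eventually
  have hfin : (Set.range s ∪ ⋃ i, {x | ¬ (c i = 0 ∧ d i - a i = 0 ∧ -b i = 0) ∧
      c i * x ^ 2 + (d i - a i) * x + -b i = 0}).Finite := by
    refine (Set.finite_range s).union (Set.finite_iUnion fun i ↦ ?_)
    by_cases hi : c i = 0 ∧ d i - a i = 0 ∧ -b i = 0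
    · simp [hi]
    · exact (finite_setOf_quadratic_eq_zero hi).subset fun x hx ↦ hx.2
  refine hfin.subset fun x hx ↦ ?_
  have hxg : g x = x := (isClosed_eq hc continuous_id).frontier_subset hx
  by_contra hxT
  simp only [Set.mem_union, Set.mem_range, Set.mem_iUnion, Set.mem_ofPred_eq, not_or,
    not_exists] at hxT
  obtain ⟨hxs, hxq⟩ := hxT
  obtain ⟨i, hi⟩ := h (𝓝 x) fun j ↦ by
    rcases lt_or_gt_of_ne (hxs j) with h | h
    · exact Or.inr ((eventually_gt_nhds h).mono fun _ hy ↦ hy.le)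
    · exact Or.inl ((eventually_lt_nhds h).mono fun _ hy ↦ hy.le)
  obtain ⟨hx0, hxi⟩ := hi.self_of_nhds
  rw [hxg, eq_div_iff hx0] at hxi
  have hzero : c i = 0 ∧ d i - a i = 0 ∧ -b i = 0 := by
    by_contra hne
    exact hxq i ⟨hne, by linear_combination hxi⟩
  refine hx.2 (mem_interior_iff_mem_nhds.mpr ?_)
  filter_upwards [hi] with y hy
  obtain ⟨hy0, hyg⟩ := hy
  rw [hyg, div_eq_iff hy0]
  linear_combination (-y ^ 2) * hzero.1 - y * hzero.2.1 - hzero.2.2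

lemma exists_affine_of_moebius_at_infinity {g : ℝ → ℝ} {l : Filter ℝ}
    [l.NeBot] (hl : ∀ R : ℝ, ∀ᶠ x in l, R ≤ |x|) (hg : Tendsto g l l) {a b c d : ℝ}
    (hdet : a * d - b * c = 1)
    (h : ∀ᶠ x in l, c * x + d ≠ 0 ∧ g x = (a * x + b) / (c * x + d)) :
    ∃ a b : ℝ, a ≠ 0 ∧ ∀ᶠ x in l, g x = a * x + b := by
  have hc : c = 0 := by
    by_contra hc
    have hcpos : 0 < |c| := abs_pos.mpr hc
    obtain ⟨x, ⟨hx0, hx⟩, hx1, hx2⟩ := (h.and ((hg.eventually (hl (1 + |a / c|))).and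
      (hl ((|d| + |1 / c| + 1) / |c|)))).exists
    rw [eq_div_iff hx0] at hx
    have h1 : (g x - a / c) * (c * x + d) = -(1 / c) := by
      field_simp
      linear_combination c * hx - hdet
    have h2 : 1 ≤ |g x - a / c| := by
      have := abs_sub_abs_le_abs_sub (g x) (a / c)
      linarith
    have h3 : |1 / c| + 1 ≤ |c * x + d| := by
      rw [div_le_iff₀ hcpos, mul_comm, ← abs_mul] at hx2
      have := abs_sub_abs_le_abs_sub (c * x) (-d)
      rw [sub_neg_eq_add, abs_neg] at this
      linarith
    have h4 := congrArg abs h1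
    rw [abs_mul, abs_neg] at h4
    nlinarith [abs_nonneg (1 / c)]
  subst hc
  have hd : d ≠ 0 := by rintro rfl; simp at hdet
  have ha : a ≠ 0 := by rintro rfl; simp at hdet
  refine ⟨a / d, b / d, div_ne_zero ha hd, ?_⟩
  filter_upwards [h] with x hx
  rw [hx.2, zero_mul, zero_add]
  ring

lemma exists_affine_of_moebius_at_fixed {g : ℝ → ℝ} {l : Filter ℝ} {t : ℝ}
    (hl : ∀ᶠ x in l, x ≠ t) (hgt : g t = t) {a b c d : ℝ}
    (hdet : a * d - b * c = 1) (ht : c * t + d ≠ 0 ∧ g t = (a * t + b) / (c * t + d))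
    (h : ∀ᶠ x in l, c * x + d ≠ 0 ∧ g x = (a * x + b) / (c * x + d)) :
    ∃ a b : ℝ, a ≠ 0 ∧ ∀ᶠ x in l, (g x - t)⁻¹ = a * (x - t)⁻¹ + b := by
  obtain ⟨ht0, ht⟩ := ht
  rw [hgt, eq_div_iff ht0] at ht
  refine ⟨(c * t + d) ^ 2, c * (c * t + d), pow_ne_zero 2 ht0, ?_⟩
  filter_upwards [hl, h] with x hx hgx
  obtain ⟨hx0, hgx⟩ := hgx
  have hxt : x - t ≠ 0 := sub_ne_zero.mpr hx
  have h1 : g x - t = (x - t) / ((c * x + d) * (c * t + d)) := by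
    rw [hgx, div_sub' hx0, div_eq_div_iff hx0 (mul_ne_zero hx0 ht0)]
    linear_combination (c * x + d) * ((x - t) * hdet + (-(c * x + d)) * ht)
  rw [h1, inv_div]
  field_simp
  ring

namespace LineAction

lemma eventually_eq_self_at_infinity {E : Type*} [Group E] {ρ : E →* Equiv.Perm ℝ}
    (hpp : ∀ e, IsPiecewiseProjective (ρ e)) {l : Filter ℝ} [l.NeBot]
    (hl : ∀ R : ℝ, ∀ᶠ x in l, R ≤ |x|)
    (hside : ∀ r : ℝ, (∀ᶠ x in l, x ≤ r) ∨ ∀ᶠ x in l, r ≤ x)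
    (hten : ∀ e, Tendsto (ρ e) l l) {e : E} (he : e ∈ derivedSeries E 2) :
    ∀ᶠ x in l, ρ e x = x := by
  refine eventually_apply_eq_self_of_affine (u := id) Function.injective_id hten (fun e ↦ ?_) he
  obtain ⟨a, b, c, d, hdet, h⟩ := (hpp e).exists_moebius hside
  exact exists_affine_of_moebius_at_infinity hl (hten e) hdet h

lemma eventually_eq_self_at_fixed {E : Type*} [Group E] {ρ : E →* Equiv.Perm ℝ}
    (hpp : ∀ e, IsPiecewiseProjective (ρ e)) {t : ℝ} (ht : ∀ e, ρ e t = t) {l l' : Filter ℝ}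
    (hl : ∀ᶠ x in l, x ≠ t) (hll' : l ≤ l') (hl' : pure t ≤ l')
    (hside : ∀ r : ℝ, (∀ᶠ x in l', x ≤ r) ∨ ∀ᶠ x in l', r ≤ x)
    (hten : ∀ e, Tendsto (ρ e) l l) {e : E} (he : e ∈ derivedSeries E 2) :
    ∀ᶠ x in l, ρ e x = x := by
  refine eventually_apply_eq_self_of_affine (u := fun x ↦ (x - t)⁻¹)
    (inv_injective.comp sub_left_injective) hten (fun e ↦ ?_) he
  obtain ⟨a, b, c, d, hdet, h⟩ := (hpp e).exists_moebius hside
  exact exists_affine_of_moebius_at_fixed hl (ht e) hdet (hl' h) (hll' h)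

lemma continuous_apply {E : Type*} [Group E] {ρ : E →* Equiv.Perm ℝ}
    (hρ : ∀ e, StrictMono (ρ e)) (e : E) : Continuous (ρ e) :=
  (hρ e).monotone.continuous_of_surjective (ρ e).surjective

lemma exists_right_germ {E : Type*} [Group E] {ρ : E →* Equiv.Perm ℝ}
    (hρ : ∀ e, StrictMono (ρ e)) (hpp : ∀ e, IsPiecewiseProjective (ρ e)) {t : EReal}
    (ht : ∀ e (x : ℝ), (x : EReal) = t → ρ e x = x) (htop : t < ⊤) {e : E}
    (he : e ∈ derivedSeries E 2) :
    ∃ p : ℝ, t < p ∧ ∀ x : ℝ, t < x → x ≤ p → ρ e x = x := by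
  induction t with
  | top => simp at htop
  | bot =>
    have h : ∀ᶠ x in atBot, ρ e x = x := by
      refine eventually_eq_self_at_infinity hpp (fun R ↦ ?_)
        (fun r ↦ Or.inl (eventually_le_atBot r)) (fun e ↦ ?_) he
      · filter_upwards [eventually_le_atBot (-R)] with x hx
        exact le_trans (by linarith) (neg_le_abs x)
      · exact (hρ e).monotone.tendsto_atBot_atBot fun b ↦ ⟨(ρ e).symm b, by simp⟩
    obtain ⟨p, hp⟩ := eventually_atBot.mp h
    exact ⟨p, EReal.bot_lt_coe p, fun x _ hx ↦ hp x hx⟩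
  | coe t =>
    have htf : ∀ e, ρ e t = t := fun e ↦ ht e t rfl
    have h : ∀ᶠ x in 𝓝[>] t, ρ e x = x := by
      refine eventually_eq_self_at_fixed hpp htf (l' := 𝓝[≥] t) ?_
        (nhdsWithin_mono _ Set.Ioi_subset_Ici_self)
        (pure_le_nhdsWithin (Set.mem_Ici.mpr le_rfl)) (fun r ↦ ?_)
        (fun e ↦ ?_) he
      · filter_upwards [self_mem_nhdsWithin] with x hx using ne_of_gt hx
      · rcases le_or_gt r t with h | h
        · exact Or.inr (by filter_upwards [self_mem_nhdsWithin] with x hx using h.trans hx)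
        · exact Or.inl (((eventually_lt_nhds h).filter_mono nhdsWithin_le_nhds).mono
            fun _ hx ↦ hx.le)
      · have h1 := ((continuous_apply hρ e).continuousWithinAt (s := Set.Ioi t) (x := t)
          ).tendsto_nhdsWithin (t := Set.Ioi t) fun x hx ↦ by
            simpa [htf e] using hρ e hx
        rwa [htf e] at h1
    obtain ⟨p, hp, hp'⟩ := (mem_nhdsGT_iff_exists_Ioc_subset).mp h
    exact ⟨p, EReal.coe_lt_coe_iff.mpr hp, fun x hx hxp ↦ hp' ⟨EReal.coe_lt_coe_iff.mp hx, hxp⟩⟩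

lemma exists_left_germ {E : Type*} [Group E] {ρ : E →* Equiv.Perm ℝ}
    (hρ : ∀ e, StrictMono (ρ e)) (hpp : ∀ e, IsPiecewiseProjective (ρ e)) {t : EReal}
    (ht : ∀ e (x : ℝ), (x : EReal) = t → ρ e x = x) (hbot : ⊥ < t) {e : E}
    (he : e ∈ derivedSeries E 2) :
    ∃ q : ℝ, q < t ∧ ∀ x : ℝ, q ≤ x → x < t → ρ e x = x := by
  induction t with
  | bot => simp at hbot
  | top =>
    have h : ∀ᶠ x in atTop, ρ e x = x := by
      refine eventually_eq_self_at_infinity hpp (fun R ↦ ?_)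
        (fun r ↦ Or.inr (eventually_ge_atTop r)) (fun e ↦ ?_) he
      · filter_upwards [eventually_ge_atTop R] with x hx
        exact hx.trans (le_abs_self x)
      · exact (hρ e).monotone.tendsto_atTop_atTop fun b ↦ ⟨(ρ e).symm b, by simp⟩
    obtain ⟨q, hq⟩ := eventually_atTop.mp h
    exact ⟨q, EReal.coe_lt_top q, fun x hx _ ↦ hq x hx⟩
  | coe t =>
    have htf : ∀ e, ρ e t = t := fun e ↦ ht e t rfl
    have h : ∀ᶠ x in 𝓝[<] t, ρ e x = x := by
      refine eventually_eq_self_at_fixed hpp htf (l' := 𝓝[≤] t) ?_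
        (nhdsWithin_mono _ Set.Iio_subset_Iic_self)
        (pure_le_nhdsWithin (Set.mem_Iic.mpr le_rfl)) (fun r ↦ ?_)
        (fun e ↦ ?_) he
      · filter_upwards [self_mem_nhdsWithin] with x hx using ne_of_lt hx
      · rcases le_or_gt t r with h | h
        · exact Or.inl (by filter_upwards [self_mem_nhdsWithin] with x hx using le_trans hx h)
        · exact Or.inr (((eventually_gt_nhds h).filter_mono nhdsWithin_le_nhds).mono
            fun _ hx ↦ hx.le)
      · have h1 := ((continuous_apply hρ e).continuousWithinAt (s := Set.Iio t) (x := t)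
          ).tendsto_nhdsWithin (t := Set.Iio t) fun x hx ↦ by
            simpa [htf e] using hρ e hx
        rwa [htf e] at h1
    obtain ⟨q, hq, hq'⟩ := (mem_nhdsLT_iff_exists_Ico_subset).mp h
    exact ⟨q, EReal.coe_lt_coe_iff.mpr hq, fun x hxq hx ↦ hq' ⟨hxq, EReal.coe_lt_coe_iff.mp hx⟩⟩

/-- A homogeneous quasimorphism on a group acting on the line by increasing piecewise projective
maps is a homomorphism if it is additive on the kernel of the action. -/
theorem map_mul_of_piecewiseProjective {E : Type*} [Group E] {F : E → ℝ}
    (hF : IsHomogeneousQuasimorphism F) {ρ : E →* Equiv.Perm ℝ} (hρ : ∀ e, StrictMono (ρ e))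
    (hpp : ∀ e, IsPiecewiseProjective (ρ e)) (hker : AdditiveOn F ρ.ker) (x y : E) :
    F (x * y) = F x + F y := by
  classical
  set K : Subgroup E := Subgroup.closure {x, y} with hK
  have hxK : x ∈ K := Subgroup.subset_closure (by simp)
  have hyK : y ∈ K := Subgroup.subset_closure (by simp)
  set Z : Set ℝ := {s | ρ x s = s} ∩ {s | ρ y s = s} with hZ
  have hZfix : ∀ s, s ∈ Z ↔ ∀ e : K, ρ e s = s := by
    refine fun s ↦ ⟨fun hs ⟨e, he⟩ ↦ ?_, fun h ↦ ⟨h ⟨x, hxK⟩, h ⟨y, hyK⟩⟩⟩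
    have hle : K ≤ (MulAction.stabilizer (Equiv.Perm ℝ) s).comap ρ := by
      rw [hK, Subgroup.closure_le]
      rintro z (rfl | rfl)
      · exact hs.1
      · exact hs.2
    exact hle he
  have hclosed : IsClosed Z := (isClosed_eq (continuous_apply hρ x) continuous_id).inter
    (isClosed_eq (continuous_apply hρ y) continuous_id)
  have hfin : (frontier Z).Finite := by
    refine (((hpp x).finite_frontier_fixed (continuous_apply hρ x)).union
      ((hpp y).finite_frontier_fixed (continuous_apply hρ y))).subset ?_
    exact (frontier_inter_subset _ _).trans
      (Set.union_subset_union Set.inter_subset_left Set.inter_subset_right)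
  set T : Finset EReal := insert ⊥ (insert ⊤ (hfin.toFinset.image fun s : ℝ ↦ (s : EReal))) with hT
  have hmem : ∀ s : ℝ, (s : EReal) ∈ T ↔ s ∈ frontier Z := by
    intro s
    simp [hT]
  have hTfix : ∀ t ∈ T, ∀ (e : K) (s : ℝ), (s : EReal) = t → ρ e s = s := by
    rintro _ ht e s rfl
    exact (hZfix s).mp (hclosed.frontier_subset ((hmem s).mp ht)) e
  have hadd := additiveOn_top_of_endpoints (hF.comp K.subtype) (ρ := ρ.comp K.subtype)
    (T := T) (fun e ↦ hρ e)
    (fun u hu v hv ↦ hker u (MonoidHom.mem_ker.mp hu) v (MonoidHom.mem_ker.mp hv))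
    (by simp [hT]) (by simp [hT]) hTfix ?_
    (fun t ht htop e he ↦ exists_right_germ (ρ := ρ.comp K.subtype) (fun e ↦ hρ e) (fun e ↦ hpp e)
      (hTfix t ht) htop he)
    (fun t ht hbot e he ↦ exists_left_germ (ρ := ρ.comp K.subtype) (fun e ↦ hρ e) (fun e ↦ hpp e)
      (hTfix t ht) hbot he)
  · exact hadd ⟨x, hxK⟩ trivial ⟨y, hyK⟩ trivial
  · intro t ht t' ht' htt hgap
    have hconn : IsPreconnected {s : ℝ | t < s ∧ (s : EReal) < t'} := by
      refine Set.OrdConnected.isPreconnected ⟨fun u hu v hv w hw ↦ ⟨?_, ?_⟩⟩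
      · exact hu.1.trans_le (EReal.coe_le_coe_iff.mpr hw.1)
      · exact lt_of_le_of_lt (EReal.coe_le_coe_iff.mpr hw.2) hv.2
    have hsub : {s : ℝ | t < s ∧ (s : EReal) < t'} ⊆ interior Z ∪ Zᶜ := by
      rintro s ⟨hs, hs'⟩
      by_cases hsZ : s ∈ Z
      · left
        by_contra hs_interior
        exact absurd (hgap s ((hmem s).mpr ⟨subset_closure hsZ, hs_interior⟩) hs) (not_le.mpr hs')
      · exact Or.inr hsZ
    have hdisj : Disjoint (interior Z) Zᶜ :=
      Set.disjoint_compl_right_iff_subset.mpr interior_subset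
    rcases hconn.subset_or_subset isOpen_interior hclosed.isOpen_compl hdisj hsub with h | h
    · exact Or.inl fun s hs hs' e ↦ (hZfix s).mp (interior_subset (h ⟨hs, hs'⟩)) e
    · refine Or.inr fun s hs hs' ↦ ?_
      have h1 := h ⟨hs, hs'⟩
      rw [Set.mem_compl_iff, hZfix] at h1
      push Not at h1
      exact h1

end LineAction

end PiecewiseProjective

/-- The central extension of `G` by `ℝ` with cocycle `ω`. -/
@[ext]
structure CentralExtension {G : Type*} [Group G] (ω : G → G → ℝ) where
  base : G
  fiber : ℝ

namespace CentralExtension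

/-- The group structure on the central extension associated with a cocycle. -/
abbrev group {G : Type*} [Group G] {ω : G → G → ℝ} (hω : IsBounded2Cocycle ω) :
    Group (CentralExtension ω) :=
  letI : Mul (CentralExtension ω) :=
    ⟨fun x y ↦ ⟨x.base * y.base, x.fiber + y.fiber + ω x.base y.base⟩⟩
  letI : One (CentralExtension ω) := ⟨⟨1, -ω 1 1⟩⟩
  letI : Inv (CentralExtension ω) :=
    ⟨fun x ↦ ⟨x.base⁻¹, -x.fiber - ω x.base⁻¹ x.base - ω 1 1⟩⟩
  Group.ofLeftAxioms
    (by
      rintro ⟨g, a⟩ ⟨h, b⟩ ⟨k, c⟩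
      refine CentralExtension.ext (mul_assoc g h k) ?_
      change a + b + ω g h + c + ω (g * h) k = a + (b + c + ω h k) + ω g (h * k)
      linear_combination -(hω.2 g h k))
    (by
      rintro ⟨g, a⟩
      refine CentralExtension.ext (one_mul g) ?_
      change -ω 1 1 + a + ω 1 g = a
      have := hω.2 1 1 g
      rw [one_mul, one_mul] at this
      linear_combination this)
    (by
      rintro ⟨g, a⟩
      refine CentralExtension.ext (inv_mul_cancel g) ?_
      change -a - ω g⁻¹ g - ω 1 1 + a + ω g⁻¹ g = -ω 1 1
      ring)

end CentralExtension

/-- A bounded cocycle is a bounded coboundary if every homogeneous quasimorphism on the associated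
central extension is a homomorphism. -/
lemma isBounded2Coboundary_of_map_mul {G : Type*} [Group G] {ω : G → G → ℝ}
    (hω : IsBounded2Cocycle ω)
    (h : letI := CentralExtension.group hω
      ∀ F : CentralExtension ω → ℝ, IsHomogeneousQuasimorphism F → ∀ x y, F (x * y) = F x + F y) :
    IsBounded2Coboundary ω := by
  let := CentralExtension.group hω
  obtain ⟨C, hC⟩ := hω.1
  obtain ⟨F, hF, hnear⟩ := IsHomogeneousQuasimorphism.exists_near
    (f := CentralExtension.fiber (ω := ω)) (D := C)
    fun x y ↦ by
      change |x.fiber + y.fiber + ω x.base y.base - x.fiber - y.fiber| ≤ C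
      convert hC x.base y.base using 2
      ring
  have hmul := h F hF
  have hmul' : ∀ g h a b, F ⟨g * h, a + b + ω g h⟩ = F ⟨g, a⟩ + F ⟨h, b⟩ :=
    fun g h a b ↦ hmul ⟨g, a⟩ ⟨h, b⟩
  have hcentral : ∀ a, F ⟨1, a - ω 1 1⟩ = a := by
    intro a
    have h0 := eq_zero_of_bounded_of_doubling (P := fun _ ↦ True)
      (δ := fun a ↦ F ⟨1, a - ω 1 1⟩ - a) (C := C + |ω 1 1|) ?_ ?_ a trivial
    · linarith
    · intro a _
      have h1 := abs_le.mp (hnear ⟨1, a - ω 1 1⟩)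
      have h2 := abs_le.mp (le_refl |ω 1 1|)
      exact abs_le.mpr ⟨by linarith, by linarith⟩
    · intro a _
      refine ⟨2 * a, trivial, le_of_eq ?_⟩
      have h1 := hmul' 1 1 (a - ω 1 1) (a - ω 1 1)
      rw [one_mul, show a - ω 1 1 + (a - ω 1 1) + ω 1 1 = 2 * a - ω 1 1 by ring] at h1
      rw [h1, ← two_mul, ← mul_sub, abs_mul, abs_two]
  refine ⟨fun g ↦ F ⟨g, 0⟩, ⟨C, fun g ↦ by simpa using hnear ⟨g, 0⟩⟩, fun g h ↦ ?_⟩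
  have h1 := hmul' g h 0 0
  have h2 := hmul' (g * h) 1 0 (ω g h - ω 1 1)
  have h3 : ω (g * h) 1 = ω 1 1 := by
    have := hω.2 (g * h) 1 1
    rw [mul_one, mul_one] at this
    linarith
  rw [hcentral, h3, mul_one, show 0 + (ω g h - ω 1 1) + ω 1 1 = 0 + 0 + ω g h by ring, h1] at h2
  linarith

/-- Any group of piecewise projective homeomorphisms of the real
line (modelled as increasing bijections of `ℝ` that are piecewise Möbius) has
vanishing second bounded cohomology: every bounded 2-cocycle is a bounded
2-coboundary. -/
theorem piecewiseProjective_vanishing_H2b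
    (G : Subgroup (Equiv.Perm ℝ))
    (hG : ∀ g ∈ G, StrictMono ⇑g ∧ IsPiecewiseProjective ⇑g)
    (ω : G → G → ℝ) (hω : IsBounded2Cocycle ω) :
    IsBounded2Coboundary ω := by
  refine isBounded2Coboundary_of_map_mul hω ?_
  let := CentralExtension.group hω
  intro F hF
  let π : CentralExtension ω →* G :=
    { toFun := CentralExtension.base
      map_one' := rfl
      map_mul' := fun _ _ ↦ rfl }
  refine LineAction.map_mul_of_piecewiseProjective hF (ρ := G.subtype.comp π)
    (fun e ↦ (hG _ e.base.2).1) (fun e ↦ (hG _ e.base.2).2) ?_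
  rintro ⟨g, a⟩ hx ⟨h, b⟩ hy
  obtain rfl : g = 1 := by simpa [π, MonoidHom.mem_ker] using hx
  obtain rfl : h = 1 := by simpa [π, MonoidHom.mem_ker] using hy
  have hcomm : Commute (⟨1, a⟩ : CentralExtension ω) ⟨1, b⟩ := by
    refine CentralExtension.ext rfl ?_
    change a + b + ω 1 1 = b + a + ω 1 1
    ring
  refine hF.map_mul_of_commute (N := ⊥) ?_
    (IsHomogeneousQuasimorphism.commutator_mem_iff_commute_mk.mp ?_)
  · intro x hx y hy
    rw [Subgroup.mem_bot] at hx hy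
    simp [hx, hy, hF.map_one]
  · exact Subgroup.mem_bot.mpr (commutatorElement_eq_one_iff_commute.mpr hcomm)
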